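/- Let {K_n : n ∈ ℕ} be a partition of ℕ into nonempty sets and I_n an ideal on K_n for each n; let I = ⊕_n I_n be the direct sum ideal (A ∈ I iff A ∩ K_n ∈ I_n for all n). Then c_{0,I}(X) is isometrically isomorphic to the ℓ∞-sum of the spaces c_{0,I_n}(X), via x ↦ (x restricted to K_n)_n. -/

import Mathlib

open BoundedContinuousFunction

variable {X : Type*} [NormedAddCommGroup X] [NormedSpace ℝ X] [CompleteSpace X]

/-- Restriction of a bounded sequence to a subset `K ⊆ ℕ`. -/
noncomputable def restrict (K : Set ℕ) (x : ℕ →ᵇ X) : ↥K →ᵇ X :=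
  x.compContinuous ⟨Subtype.val, continuous_subtype_val⟩

/-- If `{K n}` is a partition of `ℕ` into nonempty sets, `I n` an ideal on `K n`, and
`I = ⊕ₙ I n` the direct sum ideal, then `c_{0,I}(X)` is isometrically isomorphic to the
`ℓ∞`-sum of the spaces `c_{0,I n}(X)`, via `x ↦ (x ↾ K n)ₙ`. -/
theorem c0_directSum_iso_ellInftySum
    (X : Type*) [NormedAddCommGroup X] [NormedSpace ℝ X] [CompleteSpace X]
    (K : ℕ → Set ℕ) (hne : ∀ n, (K n).Nonempty)
    (hdisj : ∀ m n, m ≠ n → Disjoint (K m) (K n))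
    (hcover : (⋃ n, K n) = Set.univ)
    (I : ℕ → Set (Set ℕ))
    (hIsub : ∀ n, ∀ A ∈ I n, A ⊆ K n)
    (hdown : ∀ n, ∀ {A B : Set ℕ}, A ⊆ B → B ∈ I n → A ∈ I n)
    (hunion : ∀ n, ∀ {A B : Set ℕ}, A ∈ I n → B ∈ I n → A ∪ B ∈ I n)
    (hfin : ∀ n, ∀ A : Set ℕ, A.Finite → A ⊆ K n → A ∈ I n) :
    let Idl : Set (Set ℕ) := {A | ∀ n, A ∩ K n ∈ I n}
    let c0I : Set (ℕ →ᵇ X) := {x | ∀ ε > (0 : ℝ), {n | ε ≤ ‖x n‖} ∈ Idl}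
    let c0In : ∀ n, Set (↥(K n) →ᵇ X) :=
      fun n => {y | ∀ ε > (0 : ℝ), Subtype.val '' {a : ↥(K n) | ε ≤ ‖y a‖} ∈ I n}
    let L : Set (∀ n, ↥(K n) →ᵇ X) :=
      {y | (∀ n, y n ∈ c0In n) ∧ ∃ C : ℝ, ∀ n, ‖y n‖ ≤ C}
    let Φ : (ℕ →ᵇ X) → ∀ n, ↥(K n) →ᵇ X := fun x n => restrict (K n) x
    (∀ x ∈ c0I, Φ x ∈ L) ∧
    (∀ x ∈ c0I, ∀ x' ∈ c0I, Φ x = Φ x' → x = x') ∧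
    (∀ y ∈ L, ∃ x ∈ c0I, Φ x = y) ∧
    (∀ x ∈ c0I, (⨆ n, ‖Φ x n‖) = ‖x‖) ∧
    (∀ x x' : ℕ →ᵇ X, Φ (x + x') = Φ x + Φ x') ∧
    (∀ (c : ℝ) (x : ℕ →ᵇ X), Φ (c • x) = c • Φ x) := by
  intro Idl c0I c0In L Φ
  have hΦ : ∀ x n (a : ↥(K n)), Φ x n a = x a := fun x n a => rfl
  have hmem : ∀ k : ℕ, ∃ n, k ∈ K n := fun k => by
    have : k ∈ ⋃ n, K n := by rw [hcover]; trivial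
    simpa using this
  have hle : ∀ x n, ‖Φ x n‖ ≤ ‖x‖ := fun x n =>
    (BoundedContinuousFunction.norm_le (norm_nonneg x)).2 fun a => x.norm_coe_le_norm a
  have hset : ∀ (x : ℕ →ᵇ X) n (ε : ℝ),
      Subtype.val '' {a : ↥(K n) | ε ≤ ‖Φ x n a‖} = {k | ε ≤ ‖x k‖} ∩ K n := by
    intro x n ε
    ext k
    constructor
    · rintro ⟨a, ha, rfl⟩
      exact ⟨ha, a.2⟩
    · rintro ⟨h1, h2⟩
      exact ⟨⟨k, h2⟩, h1, rfl⟩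
  refine ⟨?_, ?_, ?_, ?_, ?_, ?_⟩
  · intro x hx
    refine ⟨fun n ε hε => ?_, ‖x‖, hle x⟩
    rw [hset]
    exact hx ε hε n
  · intro x _ x' _ h
    ext k
    obtain ⟨n, hn⟩ := hmem k
    exact DFunLike.congr_fun (congrFun h n) (⟨k, hn⟩ : ↥(K n))
  · rintro y ⟨hy, C, hC⟩
    choose p hp using hmem
    let x : ℕ →ᵇ X := BoundedContinuousFunction.ofNormedAddCommGroupDiscrete
      (fun k => y (p k) ⟨k, hp k⟩) C
      (fun k => ((y (p k)).norm_coe_le_norm _).trans (hC _))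
    have hxy : Φ x = y := by
      funext n
      ext a
      obtain ⟨k, hk⟩ := a
      change y (p k) ⟨k, hp k⟩ = y n ⟨k, hk⟩
      have hpn : p k = n := by
        by_contra hne'
        exact Set.disjoint_left.1 (hdisj _ _ hne') (hp k) hk
      subst hpn
      rfl
    refine ⟨x, fun ε hε n => ?_, hxy⟩
    rw [← hset, hxy]
    exact hy n ε hε
  · intro x _
    apply le_antisymm (ciSup_le (hle x))
    have hb : BddAbove (Set.range fun n => ‖Φ x n‖) :=
      ⟨‖x‖, by rintro _ ⟨n, rfl⟩; exact hle x n⟩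
    refine (BoundedContinuousFunction.norm_le
      (Real.iSup_nonneg fun n => norm_nonneg _)).2 fun k => ?_
    obtain ⟨n, hn⟩ := hmem k
    exact ((Φ x n).norm_coe_le_norm ⟨k, hn⟩).trans (le_ciSup hb n)
  · intro x x'
    rfl
  · intro c x
    rfl
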